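/- Let A ∈ ℝ^{m×n}, b ∈ ℝᵐ, and λ ∈ ℝⁿ with λ_1 ≥ λ_2 ≥ ⋯ ≥ λ_n ≥ 0. If x* minimizes f(x) = ½‖Ax − b‖² + κ_λ(x) over ℝⁿ, then y* := Ax* − b satisfies −Aᵀy* ∈ C_λ and the primal and dual optimal values coincide: ½‖Ax* − b‖² + κ_λ(x*) = −⟨b, y*⟩ − ½‖y*‖². -/

import Mathlib

open Matrix

/-- `absDown x` is the vector of the absolute values of the entries of `x`
arranged in non-increasing order, i.e. `|x|^↓`. -/
noncomputable def absDown {n : ℕ} (x : Fin n → ℝ) : Fin n → ℝ :=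
  fun i => |x (Tuple.sort (fun k => -|x k|) i)|

/-- The decreasing weighted sorted ℓ₁ (DWSL1) function `κ_λ(x) = ∑ λ_i |x|_i^↓`. -/
noncomputable def kappa {n : ℕ} (lam x : Fin n → ℝ) : ℝ :=
  ∑ i, lam i * absDown x i

/-- A signed permutation matrix: exactly one nonzero entry in each row and
each column, and every entry is `0`, `1` or `-1`. -/
def IsSignedPerm {n : ℕ} (π : Matrix (Fin n) (Fin n) ℝ) : Prop :=
  (∀ i, ∃! j, π i j ≠ 0) ∧ (∀ j, ∃! i, π i j ≠ 0) ∧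
    ∀ i j, π i j = 0 ∨ π i j = 1 ∨ π i j = -1

/-- The matrix `B` with `(Bx)_i = x_i - x_{i+1}` for `i < n-1` and `(Bx)_{n-1} = x_{n-1}`. -/
def Bmat (n : ℕ) : Matrix (Fin n) (Fin n) ℝ :=
  Matrix.of fun i j => if j = i then 1 else if (j : ℕ) = (i : ℕ) + 1 then -1 else 0

/-- `B_Γ`: the submatrix of `B` consisting of the rows indexed by `Γ`. -/
def Brows {n : ℕ} (Γ : Finset (Fin n)) : Matrix {i // i ∈ Γ} (Fin n) ℝ :=
  Matrix.of fun i j => Bmat n i.1 j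

/-- `P = Iₙ - B_Γᵀ (B_Γ B_Γᵀ)⁻¹ B_Γ`. -/
noncomputable def Pmat {n : ℕ} (Γ : Finset (Fin n)) : Matrix (Fin n) (Fin n) ℝ :=
  1 - (Brows Γ)ᵀ * (Brows Γ * (Brows Γ)ᵀ)⁻¹ * Brows Γ

/-- The Euclidean norm on `Fin n → ℝ`. -/
noncomputable def eucNorm {n : ℕ} (x : Fin n → ℝ) : ℝ := Real.sqrt (∑ i, (x i) ^ 2)

/-- Membership in the set `C_λ = {z : ∑_{j ≤ i} |z|_j^↓ ≤ ∑_{j ≤ i} λ_j for all i}`. -/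
def memC {n : ℕ} (lam z : Fin n → ℝ) : Prop :=
  ∀ i : Fin n, ∑ j ∈ Finset.Iic i, absDown z j ≤ ∑ j ∈ Finset.Iic i, lam j

/-- Rearrangement: a weighted sum with antitone weights is largest along a permutation that
sorts the values in non-increasing order. -/
theorem sum_mul_comp_perm_le_of_antitone {n : ℕ} {lam f : Fin n → ℝ} (hmono : Antitone lam)
    {σ : Equiv.Perm (Fin n)} (hf : Antitone (f ∘ σ)) (ρ : Equiv.Perm (Fin n)) :
    ∑ i, lam i * f (ρ i) ≤ ∑ i, lam i * f (σ i) := by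
  have h := (hmono.monovary hf).sum_mul_comp_perm_le_sum_mul (σ := σ⁻¹ * ρ)
  simpa using h

theorem antitone_absDown {n : ℕ} (x : Fin n → ℝ) : Antitone (absDown x) := by
  intro i j hij
  simpa [absDown] using Tuple.monotone_sort (fun k => -|x k|) hij

theorem kappa_le_of_antitone {n : ℕ} {lam x : Fin n → ℝ} (hmono : Antitone lam)
    {σ : Equiv.Perm (Fin n)} (hσ : Antitone fun i => |x (σ i)|) :
    kappa lam x ≤ ∑ i, lam i * |x (σ i)| :=
  sum_mul_comp_perm_le_of_antitone (f := fun k => |x k|) hmono hσ _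

theorem sum_mul_abs_comp_perm_le_kappa {n : ℕ} {lam : Fin n → ℝ} (hmono : Antitone lam)
    (x : Fin n → ℝ) (ρ : Equiv.Perm (Fin n)) :
    ∑ i, lam i * |x (ρ i)| ≤ kappa lam x :=
  sum_mul_comp_perm_le_of_antitone (f := fun k => |x k|) hmono (antitone_absDown x) ρ

theorem kappa_add_smul_le {n : ℕ} {lam : Fin n → ℝ} (hmono : Antitone lam)
    (hpos : ∀ i, 0 ≤ lam i) (x h : Fin n → ℝ) {s t : ℝ} (hs : 0 ≤ s) (ht : 0 ≤ t) :
    kappa lam (s • x + t • h) ≤ s * kappa lam x + t * kappa lam h := by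
  set ρ := Tuple.sort (fun k => -|(s • x + t • h) k|) with hρ
  calc kappa lam (s • x + t • h)
      = ∑ i, lam i * |s * x (ρ i) + t * h (ρ i)| := by
        simp [kappa, absDown, hρ]
    _ ≤ ∑ i, (s * (lam i * |x (ρ i)|) + t * (lam i * |h (ρ i)|)) := by
        refine Finset.sum_le_sum fun i _ => ?_
        have h1 := abs_add_le (s * x (ρ i)) (t * h (ρ i))
        rw [abs_mul, abs_mul, abs_of_nonneg hs, abs_of_nonneg ht] at h1
        linarith [mul_le_mul_of_nonneg_left h1 (hpos i)]
    _ ≤ s * kappa lam x + t * kappa lam h := by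
        rw [Finset.sum_add_distrib, ← Finset.mul_sum, ← Finset.mul_sum]
        gcongr <;> exact sum_mul_abs_comp_perm_le_kappa hmono _ _

/-- A vector whose associated linear functional is dominated by `κ_λ` lies in `C_λ`. -/
theorem memC_of_forall_sum_mul_le_kappa {n : ℕ} {lam : Fin n → ℝ} (hmono : Antitone lam)
    {z : Fin n → ℝ} (hz : ∀ h : Fin n → ℝ, ∑ i, z i * h i ≤ kappa lam h) : memC lam z := by
  intro i
  set σ := Tuple.sort (fun k => -|z k|) with hσ
  set h : Fin n → ℝ := fun k => if σ.symm k ≤ i then (if 0 ≤ z k then 1 else -1) else 0 with hh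
  have habs : ∀ j, |h (σ j)| = if j ≤ i then 1 else 0 := by
    intro j
    simp only [hh, Equiv.symm_apply_apply]
    split_ifs <;> simp
  have hanti : Antitone fun j => |h (σ j)| := by
    intro j k hjk
    simp only [habs]
    split_ifs with h1 h2
    · exact le_rfl
    · exact absurd (hjk.trans h1) h2
    · exact zero_le_one
    · exact le_rfl
  have hprod : ∀ j, z (σ j) * h (σ j) = if j ≤ i then absDown z j else 0 := by
    intro j
    simp only [hh, Equiv.symm_apply_apply, absDown, ← hσ]
    split_ifs with h1 h2
    · rw [abs_of_nonneg h2, mul_one]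
    · rw [abs_of_neg (not_le.mp h2), mul_neg_one]
    · rw [mul_zero]
  have hIic : Finset.Iic i = Finset.univ.filter (· ≤ i) := by ext; simp
  calc ∑ j ∈ Finset.Iic i, absDown z j = ∑ j, z (σ j) * h (σ j) := by
        simp only [hprod, hIic, Finset.sum_filter]
    _ = ∑ k, z k * h k := Equiv.sum_comp σ fun k => z k * h k
    _ ≤ kappa lam h := hz h
    _ ≤ ∑ j, lam j * |h (σ j)| := kappa_le_of_antitone hmono hanti
    _ = ∑ j ∈ Finset.Iic i, lam j := by
        simp only [habs, hIic, Finset.sum_filter, mul_ite, mul_one, mul_zero]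

theorem nonneg_of_forall_nonneg_add_mul {a c : ℝ}
    (h : ∀ t : ℝ, 0 < t → t ≤ 1 → 0 ≤ a + t * c) : 0 ≤ a := by
  by_contra! ha
  have hc : 0 < |c| + |a| + 1 := by positivity
  have hneg : 0 < -a := neg_pos.mpr ha
  have h1 := h (-a / (|c| + |a| + 1)) (by positivity)
    ((div_le_one hc).mpr (by linarith [neg_le_abs a, abs_nonneg c]))
  have h2 : -a / (|c| + |a| + 1) * c < -a := by
    rw [div_mul_eq_mul_div, div_lt_iff₀ hc]
    nlinarith [le_abs_self c, abs_nonneg a]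
  linarith

/-- First-order optimality along a direction `d` in which the penalty grows at rate at most `K`. -/
theorem nonneg_directional_of_isMin {m n : ℕ} {A : Matrix (Fin m) (Fin n) ℝ} {b : Fin m → ℝ}
    {g : (Fin n → ℝ) → ℝ} {xs : Fin n → ℝ}
    (hmin : ∀ x : Fin n → ℝ,
      (1 / 2) * ∑ i, (A.mulVec xs i - b i) ^ 2 + g xs ≤
        (1 / 2) * ∑ i, (A.mulVec x i - b i) ^ 2 + g x)
    {d : Fin n → ℝ} {K : ℝ}
    (hK : ∀ t : ℝ, 0 < t → t ≤ 1 → g (xs + t • d) ≤ g xs + t * K) :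
    0 ≤ (A.mulVec xs - b) ⬝ᵥ A.mulVec d + K := by
  refine nonneg_of_forall_nonneg_add_mul (c := (1 / 2) * ∑ i, (A.mulVec d i) ^ 2)
    fun t ht ht1 => ?_
  have hexp : ∑ i, (A.mulVec (xs + t • d) i - b i) ^ 2 =
      ∑ i, (A.mulVec xs i - b i) ^ 2 + 2 * t * ((A.mulVec xs - b) ⬝ᵥ A.mulVec d)
        + t ^ 2 * ∑ i, (A.mulVec d i) ^ 2 := by
    simp only [dotProduct, Finset.mul_sum, ← Finset.sum_add_distrib]
    refine Finset.sum_congr rfl fun i _ => ?_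
    simp only [Matrix.mulVec_add, Matrix.mulVec_smul, Pi.add_apply, Pi.smul_apply, Pi.sub_apply,
      smul_eq_mul]
    ring
  have h1 := hmin (xs + t • d)
  rw [hexp] at h1
  refine nonneg_of_mul_nonneg_right (a := t) ?_ ht
  nlinarith [hK t ht ht1]

/-- Strong duality for SLOPE: if `x*` is a primal minimizer, then
`y* = Ax* - b` is dual feasible and the optimal values coincide. -/
theorem stmt17 {m n : ℕ} (A : Matrix (Fin m) (Fin n) ℝ) (b : Fin m → ℝ)
    (lam : Fin n → ℝ) (hmono : Antitone lam) (hpos : ∀ i, 0 ≤ lam i)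
    (xs : Fin n → ℝ)
    (hmin : ∀ x : Fin n → ℝ,
      (1 / 2) * ∑ i, (A.mulVec xs i - b i) ^ 2 + kappa lam xs ≤
        (1 / 2) * ∑ i, (A.mulVec x i - b i) ^ 2 + kappa lam x) :
    memC lam (-(Aᵀ.mulVec (A.mulVec xs - b))) ∧
    (1 / 2) * ∑ i, (A.mulVec xs i - b i) ^ 2 + kappa lam xs =
      -(∑ i, b i * (A.mulVec xs - b) i) - (1 / 2) * ∑ i, ((A.mulVec xs - b) i) ^ 2 := by
  have hfeas : ∀ h : Fin n → ℝ,
      0 ≤ (A.mulVec xs - b) ⬝ᵥ A.mulVec h + kappa lam h := fun h =>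
    nonneg_directional_of_isMin hmin fun t ht _ => by
      simpa using kappa_add_smul_le hmono hpos xs h zero_le_one ht.le
  have hcompl : 0 ≤ (A.mulVec xs - b) ⬝ᵥ A.mulVec (-xs) + -kappa lam xs :=
    nonneg_directional_of_isMin hmin fun t _ ht1 => by
      have h := kappa_add_smul_le hmono hpos xs 0 (sub_nonneg.mpr ht1) le_rfl
      have hx : xs + t • -xs = (1 - t) • xs + (0 : ℝ) • (0 : Fin n → ℝ) := by
        module
      rw [hx]
      linarith
  refine ⟨memC_of_forall_sum_mul_le_kappa hmono fun h => ?_, ?_⟩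
  · have h1 := hfeas h
    rw [Matrix.dotProduct_mulVec, ← Matrix.mulVec_transpose] at h1
    change -(Aᵀ.mulVec (A.mulVec xs - b)) ⬝ᵥ h ≤ _
    rw [neg_dotProduct]
    linarith
  · rw [Matrix.mulVec_neg, dotProduct_neg] at hcompl
    have hkappa : kappa lam xs = -((A.mulVec xs - b) ⬝ᵥ A.mulVec xs) := by
      linarith [hfeas xs]
    rw [hkappa]
    simp only [dotProduct, Pi.sub_apply, Finset.mul_sum, ← Finset.sum_neg_distrib,
      ← Finset.sum_add_distrib, ← Finset.sum_sub_distrib]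
    exact Finset.sum_congr rfl fun i _ => by ring
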